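/- Assume a ≠ 0, v(a) ≤ 1, and b ∈ p whenever v(a) = 1. Then for all integers m, n ≥ 0 one has the equality of double cosets T(F)·diag(ϖ^{−m}, 1)·K₁(pⁿ) = T(F)·diag(ϖ^{m − v(a)}, 1)·w·K₁(pⁿ) as subsets of GL₂(F). -/

import Mathlib

open scoped Pointwise
open Matrix

noncomputable section

abbrev Zm0 : Type := WithZero (Multiplicative ℤ)

/-- `ev n` is the value (in `ℤₘ₀ = WithZero (Multiplicative ℤ)`) of an element of additive
valuation `n`; thus `x ∈ 𝔭^n` iff `v x ≤ ev n`, `x ∈ 𝔬` iff `v x ≤ ev 0`, `x ∈ 𝔬^×` iff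
`v x = ev 0`, and "v(x) = n" (additively) iff `v x = ev n`. -/
def ev (n : ℤ) : Zm0 := ((Multiplicative.ofAdd (-n) : Multiplicative ℤ) : Zm0)

variable {F : Type*} [Field F]

/-- the matrix t(x,y) = [[x, cy],[−ay, x−by]] -/
def tmat (a b c x y : F) : Matrix (Fin 2) (Fin 2) F :=
  !![x, c * y; -(a * y), x - b * y]

/-- the torus T(F) ⊆ GL₂(F), as a set of matrices -/
def TSet (a b c : F) : Set (Matrix (Fin 2) (Fin 2) F) :=
  {m | ∃ x y : F, x ^ 2 - b * x * y + a * c * y ^ 2 ≠ 0 ∧ m = tmat a b c x y}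

def wmat (F : Type*) [Field F] : Matrix (Fin 2) (Fin 2) F := !![0, 1; -1, 0]

/-- GL₂(𝔬) : integral entries and unit determinant -/
def GL2O (v : Valuation F Zm0) : Set (Matrix (Fin 2) (Fin 2) F) :=
  {g | (∀ i j, v (g i j) ≤ ev 0) ∧ v g.det = ev 0}

/-- K₁(𝔭ⁿ) = { g ∈ GL₂(𝔬) : g₂₁ ∈ 𝔭ⁿ, g₂₂ ∈ 1 + 𝔭ⁿ } -/
def K1 (v : Valuation F Zm0) (n : ℕ) : Set (Matrix (Fin 2) (Fin 2) F) :=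
  {g | g ∈ GL2O v ∧ v (g 1 0) ≤ ev n ∧ v (g 1 1 - 1) ≤ ev n}

theorem aux_ev_zero : ev 0 = 1 := by
  simp [ev]

theorem aux_ev_mul (i j : ℤ) : ev i * ev j = ev (i + j) := by
  simp only [ev, ← WithZero.coe_mul, ← ofAdd_add]
  congr 2
  ring

theorem aux_ev_le {i j : ℤ} (h : i ≤ j) : ev j ≤ ev i := by
  simp only [ev, WithZero.coe_le_coe, Multiplicative.ofAdd_le]
  omega

theorem aux_ev_zpow (i : ℤ) : (ev 1) ^ i = ev i := by
  simp only [ev, ← WithZero.coe_zpow, ← ofAdd_zsmul]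
  congr 2
  simp

theorem aux_T_mul {a b c : F} {s t : Matrix (Fin 2) (Fin 2) F}
    (hs : s ∈ TSet a b c) (ht : t ∈ TSet a b c) : s * t ∈ TSet a b c := by
  obtain ⟨x, y, h, rfl⟩ := hs
  obtain ⟨z, w, h', rfl⟩ := ht
  refine ⟨x * z - a * c * y * w, x * w + y * z - b * y * w, ?_, ?_⟩
  · convert mul_ne_zero h h' using 1
    ring
  · ext i j
    fin_cases i <;> fin_cases j <;> simp [tmat, Matrix.mul_apply, Fin.sum_univ_two] <;> ring

theorem aux_K_mul (v : Valuation F Zm0) (n : ℕ) {u s : F} (hu : v u = 1) (hs : v s ≤ 1)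
    {g : Matrix (Fin 2) (Fin 2) F} (hg : g ∈ K1 v n) : !![u, s; 0, 1] * g ∈ K1 v n := by
  obtain ⟨⟨h1, h2⟩, h3, h4⟩ := hg
  rw [aux_ev_zero] at h2
  simp only [aux_ev_zero] at h1
  have key : ∀ j, v (u * g 0 j + s * g 1 j) ≤ 1 := by
    intro j
    refine (v.map_add _ _).trans (max_le ?_ ?_)
    · rw [map_mul, hu, one_mul]
      exact h1 0 j
    · rw [map_mul]
      exact mul_le_one' hs (h1 1 j)
  refine ⟨⟨?_, ?_⟩, ?_, ?_⟩
  · intro i j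
    rw [aux_ev_zero]
    fin_cases i
    · simpa [Matrix.mul_apply, Fin.sum_univ_two] using key j
    · simpa [Matrix.mul_apply, Fin.sum_univ_two] using h1 1 j
  · rw [Matrix.det_mul, map_mul, h2, aux_ev_zero, Matrix.det_fin_two_of]
    simp [hu]
  · simpa [Matrix.mul_apply, Fin.sum_univ_two] using h3
  · simpa [Matrix.mul_apply, Fin.sum_univ_two] using h4

theorem aux_sub (v : Valuation F Zm0) (n : ℕ) {a b c u s : F} (hu : v u = 1) (hs : v s ≤ 1)
    {t A B : Matrix (Fin 2) (Fin 2) F} (ht : t ∈ TSet a b c) (h : A = t * B * !![u, s; 0, 1]) :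
    TSet a b c * ({A} : Set (Matrix (Fin 2) (Fin 2) F)) * K1 v n
      ⊆ TSet a b c * ({B} : Set (Matrix (Fin 2) (Fin 2) F)) * K1 v n := by
  rintro _ ⟨_, ⟨r, hr, _, rfl, rfl⟩, k, hk, rfl⟩
  refine ⟨r * t * B, ⟨r * t, aux_T_mul hr ht, B, rfl, rfl⟩, _, aux_K_mul v n hu hs hk, ?_⟩
  simp only [h, Matrix.mul_assoc]

/-- Assume a ≠ 0, v(a) ≤ 1, and b ∈ p whenever v(a) = 1. Then for all integers
m, n ≥ 0 one has the equality of double cosets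
T(F)·diag(ϖ^{−m}, 1)·K₁(pⁿ) = T(F)·diag(ϖ^{m − v(a)}, 1)·w·K₁(pⁿ) as subsets of GL₂(F). -/
theorem stmt1
    (v : Valuation F Zm0) (ϖ : F) (hϖ : v ϖ = ev 1)
    (a b c : F)
    (hao : v a ≤ ev 0) (hbo : v b ≤ ev 0) (hc : v c = ev 0)
    (hd : b ^ 2 - 4 * (a * c) ≠ 0)
    (ha0 : a ≠ 0)
    (va : ℤ) (hva : v a = ev va) (hva1 : va ≤ 1)
    (hbp : va = 1 → v b ≤ ev 1)
    (m n : ℕ) :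
    TSet a b c * ({!![ϖ ^ (-(m : ℤ)), 0; 0, 1]} : Set (Matrix (Fin 2) (Fin 2) F)) * K1 v n
      = TSet a b c * ({!![ϖ ^ ((m : ℤ) - va), 0; 0, 1] * wmat F} :
          Set (Matrix (Fin 2) (Fin 2) F)) * K1 v n := by
  have hϖ0 : ϖ ≠ 0 := by
    rintro rfl
    simp [ev] at hϖ
  have hc0 : c ≠ 0 := by
    rintro rfl
    simp [ev] at hc
  have hpow : ∀ i : ℤ, v (ϖ ^ i) = ev i := fun i => by
    rw [map_zpow₀, hϖ, aux_ev_zpow]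
  have hva0 : 0 ≤ va := by
    rw [hva] at hao
    simp only [ev, WithZero.coe_le_coe, Multiplicative.ofAdd_le] at hao
    omega
  have hainv : v a⁻¹ = ev (-va) := by
    rw [map_inv₀, hva]
    symm
    refine eq_inv_of_mul_eq_one_left ?_
    rw [aux_ev_mul, ← aux_ev_zero]
    congr 1
    ring
  have hbva : v b ≤ ev va := by
    rcases (by omega : va = 0 ∨ va = 1) with h | h
    · rw [h]; exact hbo
    · rw [h]; exact hbp h
  -- the unit and the off-diagonal entry of the compact element
  have hu : v (c * ϖ ^ va * a⁻¹) = 1 := by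
    rw [map_mul, map_mul, hc, hpow, hainv, aux_ev_mul, aux_ev_mul, ← aux_ev_zero]
    congr 1
    ring
  have hs : v (-(b * ϖ ^ (m : ℤ) * a⁻¹)) ≤ 1 := by
    rw [Valuation.map_neg, map_mul, map_mul, hpow, hainv]
    calc v b * ev m * ev (-va) ≤ ev va * ev m * ev (-va) := by gcongr
      _ = ev m := by
        rw [aux_ev_mul, aux_ev_mul]
        congr 1
        ring
      _ ≤ ev 0 := aux_ev_le (by omega)
      _ = 1 := aux_ev_zero
  have hu' : v (c * ϖ ^ va * a⁻¹)⁻¹ = 1 := by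
    rw [map_inv₀, hu, inv_one]
  have hs' : v (-((c * ϖ ^ va * a⁻¹)⁻¹ * -(b * ϖ ^ (m : ℤ) * a⁻¹))) ≤ 1 := by
    rw [Valuation.map_neg, map_mul, hu', one_mul]
    exact hs
  have hA : ϖ ^ va ≠ 0 := zpow_ne_zero _ hϖ0
  have hM : ϖ ^ m ≠ 0 := pow_ne_zero _ hϖ0
  have e1 : ϖ ^ (-(m : ℤ)) = (ϖ ^ m)⁻¹ := by
    rw [_root_.zpow_neg, zpow_natCast]
  have e2 : ϖ ^ ((m : ℤ) - va) = ϖ ^ m / ϖ ^ va := by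
    rw [zpow_sub₀ hϖ0, zpow_natCast]
  have e3 : ϖ ^ (m : ℤ) = ϖ ^ m := zpow_natCast _ _
  rw [e3] at hs hs'
  rw [e1, e2]
  generalize ϖ ^ va = A at *
  generalize ϖ ^ m = M at *
  refine Set.Subset.antisymm
    (aux_sub v n hu' hs' (t := tmat a b c (b * (-(A / (M * a)))) (-(A / (M * a)))) ⟨_, _, ?_, rfl⟩ ?_)
    (aux_sub v n hu hs (t := tmat a b c 0 (M / (A * c))) ⟨_, _, ?_, rfl⟩ ?_)
  · have : (b * (-(A / (M * a)))) ^ 2 - b * (b * (-(A / (M * a)))) * (-(A / (M * a)))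
        + a * c * (-(A / (M * a))) ^ 2 = a * c * (A / (M * a)) ^ 2 := by ring
    rw [this]
    positivity
  · ext i j
    fin_cases i <;> fin_cases j <;>
      simp [tmat, wmat, Matrix.mul_apply, Fin.sum_univ_two] <;> field_simp <;> ring
  · have : (0 : F) ^ 2 - b * 0 * (M / (A * c)) + a * c * (M / (A * c)) ^ 2
        = a * c * (M / (A * c)) ^ 2 := by ring
    rw [this]
    positivity
  · ext i j
    fin_cases i <;> fin_cases j <;>
      simp [tmat, wmat, Matrix.mul_apply, Fin.sum_univ_two] <;> field_simp <;> ring
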